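/- arXiv:0706.1048 — 5 statements merged into one kernel-verified Lean document; each statement's English description precedes it below -/
import Mathlib

section
/- Let N ≥ 1, let R : ℝ^N → ℝ^N be a C¹ vector field, and let K ⊂ ℝ^N be compact. Then sup over x ∈ K and unit vectors ν ∈ ℝ^N of | ‖(I + δ DR(x))^{-1} ν‖ − 1 + δ ⟨ν, DR(x) ν⟩ | = o(|δ|) as δ → 0; here I + δ DR(x) is invertible for all x ∈ K once |δ| · sup_{x∈K} ‖DR(x)‖ < 1. -/
open MeasureTheory Filter Topology Asymptotics
open scoped ENNReal NNReal RealInnerProductSpace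

/-- In a complete normed algebra, `1 + δ • A` is invertible once `|δ| * ‖A‖ < 1`. -/
theorem isUnit_one_add_smul_of_abs_mul_norm_lt_one {A : Type*} [NormedRing A]
    [NormedAlgebra ℝ A] [CompleteSpace A] {a : A} {δ : ℝ} (h : |δ| * ‖a‖ < 1) :
    IsUnit (1 + δ • a) := by
  have key : ‖-(δ • a)‖ < 1 := by rwa [norm_neg, norm_smul, Real.norm_eq_abs]
  simpa using isUnit_one_sub_of_norm_lt_one key

section InnerProductSpace

variable {E : Type*} [NormedAddCommGroup E] [InnerProductSpace ℝ E]

/-- First-order expansion of the norm of a perturbation `ν - u` of a unit vector. -/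
theorem abs_norm_sub_sub_one_add_inner_le {ν u : E} (hν : ‖ν‖ = 1) (hu : ‖u‖ ≤ 1 / 2) :
    |‖ν - u‖ - 1 + ⟪ν, u⟫| ≤ ‖u‖ ^ 2 := by
  have hsq : ‖ν - u‖ ^ 2 = 1 - 2 * ⟪ν, u⟫ + ‖u‖ ^ 2 := by
    rw [norm_sub_sq_real, hν]; ring
  have hinner : |⟪ν, u⟫| ≤ ‖u‖ := by
    simpa [hν] using abs_real_inner_le_norm ν u
  have hlow : 1 - ⟪ν, u⟫ ≤ ‖ν - u‖ := by
    have h := real_inner_le_norm ν (ν - u)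
    rwa [inner_sub_right, real_inner_self_eq_norm_sq, hν, one_pow, one_mul] at h
  obtain ⟨h1, h2⟩ := abs_le.1 hinner
  rw [abs_of_nonneg (by linarith)]
  nlinarith [sq_nonneg ⟪ν, u⟫]

/-- Quantitative first-order expansion of `‖(1 + δ A)⁻¹ ν‖` for a unit vector `ν`. -/
theorem abs_norm_inverse_one_add_smul_apply_le [CompleteSpace E] {A : E →L[ℝ] E} {M δ : ℝ}
    (hA : ‖A‖ ≤ M) (hδ : |δ| * M ≤ 1 / 2) {ν : E} (hν : ‖ν‖ = 1) :
    |‖Ring.inverse (1 + δ • A) ν‖ - 1 + δ * ⟪ν, A ν⟫| ≤ 3 * M ^ 2 * δ ^ 2 := by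
  have happly (v : E) : ‖δ • A v‖ ≤ |δ| * M * ‖v‖ := by
    rw [norm_smul, Real.norm_eq_abs, mul_assoc]
    gcongr
    exact A.le_of_opNorm_le hA v
  have hM : 0 ≤ M := (norm_nonneg A).trans hA
  have hunit : IsUnit (1 + δ • A) := by
    refine isUnit_one_add_smul_of_abs_mul_norm_lt_one ?_
    have : |δ| * ‖A‖ ≤ |δ| * M := by gcongr
    linarith
  set w := Ring.inverse (1 + δ • A) ν with hw
  have hwν : w + δ • A w = ν := by
    have h := congrArg (fun B : E →L[ℝ] E => B ν) (Ring.mul_inverse_cancel _ hunit)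
    simpa [← hw] using h
  have hδM : 0 ≤ |δ| * M := by positivity
  have hwle : ‖w‖ ≤ 2 := by
    have h1 : ‖w‖ ≤ ‖ν‖ + ‖δ • A w‖ := by
      rw [← eq_sub_iff_add_eq] at hwν
      calc ‖w‖ = ‖ν - δ • A w‖ := by rw [← hwν]
        _ ≤ _ := norm_sub_le _ _
    nlinarith [happly w, norm_nonneg w]
  have hdiff : w - (ν - δ • A ν) = δ • A (δ • A w) := by
    rw [← hwν, map_add, smul_add]; abel
  have hrem : |‖w‖ - ‖ν - δ • A ν‖| ≤ 2 * (|δ| * M) ^ 2 := by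
    refine (abs_norm_sub_norm_le _ _).trans ?_
    rw [hdiff]
    calc ‖δ • A (δ • A w)‖ ≤ |δ| * M * (|δ| * M * ‖w‖) :=
          (happly _).trans (by gcongr; exact happly w)
      _ ≤ |δ| * M * (|δ| * M * 2) := by gcongr
      _ = 2 * (|δ| * M) ^ 2 := by ring
  have hu : ‖δ • A ν‖ ≤ |δ| * M := by simpa [hν] using happly ν
  have hmain := abs_norm_sub_sub_one_add_inner_le hν (hu.trans hδ)
  rw [real_inner_smul_right] at hmain
  have husq : ‖δ • A ν‖ ^ 2 ≤ (|δ| * M) ^ 2 := by gcongr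
  calc |‖w‖ - 1 + δ * ⟪ν, A ν⟫|
      = |(‖w‖ - ‖ν - δ • A ν‖) + (‖ν - δ • A ν‖ - 1 + δ * ⟪ν, A ν⟫)| := by ring_nf
    _ ≤ 2 * (|δ| * M) ^ 2 + (|δ| * M) ^ 2 :=
        (abs_add_le _ _).trans (add_le_add hrem (hmain.trans husq))
    _ = 3 * M ^ 2 * δ ^ 2 := by rw [mul_pow, sq_abs]; ring

end InnerProductSpace

/-- For a `C¹` vector field `R` and a compact `K`,
`sup_{x ∈ K, ‖ν‖ = 1} | ‖(I + δ DR(x))⁻¹ ν‖ − 1 + δ ⟨ν, DR(x) ν⟩ | = o(δ)` as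
`δ → 0` (the inverse is taken in the ring of continuous endomorphisms, with
junk value `0` when not invertible); moreover `I + δ DR(x)` is invertible for
all `x ∈ K` once `|δ| · sup_{x ∈ K} ‖DR(x)‖ < 1`. -/
theorem inverse_norm_expansion
    (N : ℕ) (hN : 1 ≤ N)
    (R : EuclideanSpace ℝ (Fin N) → EuclideanSpace ℝ (Fin N))
    (hR : ContDiff ℝ 1 R)
    (K : Set (EuclideanSpace ℝ (Fin N))) (hK : IsCompact K) :
    ((fun δ : ℝ => ⨆ x ∈ K, ⨆ ν ∈ Metric.sphere (0 : EuclideanSpace ℝ (Fin N)) 1,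
        |‖Ring.inverse
            ((1 : EuclideanSpace ℝ (Fin N) →L[ℝ] EuclideanSpace ℝ (Fin N))
              + δ • fderiv ℝ R x) ν‖
          - 1 + δ * ⟪ν, fderiv ℝ R x ν⟫|)
      =o[𝓝 0] fun δ : ℝ => δ) ∧
    (∀ δ : ℝ, |δ| * (⨆ x ∈ K, ‖fderiv ℝ R x‖) < 1 → ∀ x ∈ K,
      IsUnit ((1 : EuclideanSpace ℝ (Fin N) →L[ℝ] EuclideanSpace ℝ (Fin N))
        + δ • fderiv ℝ R x)) := by
  obtain ⟨C, hC⟩ := hK.exists_bound_of_continuousOn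
    (hR.continuous_fderiv one_ne_zero).continuousOn
  obtain ⟨M, hM, hb⟩ : ∃ M : ℝ, 0 ≤ M ∧ ∀ x ∈ K, ‖fderiv ℝ R x‖ ≤ M :=
    ⟨max C 0, le_max_right _ _, fun x hx => (hC x hx).trans (le_max_left _ _)⟩
  refine ⟨?_, fun δ hδ x hx => ?_⟩
  · have hO : (fun δ : ℝ => ⨆ x ∈ K, ⨆ ν ∈ Metric.sphere (0 : EuclideanSpace ℝ (Fin N)) 1,
        |‖Ring.inverse
            ((1 : EuclideanSpace ℝ (Fin N) →L[ℝ] EuclideanSpace ℝ (Fin N))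
              + δ • fderiv ℝ R x) ν‖
          - 1 + δ * ⟪ν, fderiv ℝ R x ν⟫|) =O[𝓝 0] fun δ : ℝ => δ ^ 2 := by
      have hsmall : ∀ᶠ δ : ℝ in 𝓝 0, |δ| * M < 1 / 2 := by
        have hcont : Continuous fun δ : ℝ => |δ| * M := by fun_prop
        exact hcont.continuousAt.eventually_lt_const (by simp)
      refine IsBigO.of_bound (3 * M ^ 2) ?_
      filter_upwards [hsmall] with δ hδ
      have hpos : 0 ≤ 3 * M ^ 2 * δ ^ 2 := by positivity
      rw [Real.norm_of_nonneg (sq_nonneg δ), Real.norm_of_nonneg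
        (Real.iSup_nonneg fun _ => Real.iSup_nonneg fun _ => Real.iSup_nonneg fun _ =>
          Real.iSup_nonneg fun _ => abs_nonneg _)]
      exact Real.iSup_le (fun x => Real.iSup_le (fun hx => Real.iSup_le (fun ν =>
        Real.iSup_le (fun hν => abs_norm_inverse_one_add_smul_apply_le (hb x hx) hδ.le
          (mem_sphere_zero_iff_norm.1 hν)) hpos) hpos) hpos) hpos
    exact hO.trans_isLittleO (isLittleO_pow_id one_lt_two)
  · refine isUnit_one_add_smul_of_abs_mul_norm_lt_one (lt_of_le_of_lt ?_ hδ)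
    have hbdd : BddAbove (Set.range fun y => ⨆ _ : y ∈ K, ‖fderiv ℝ R y‖) :=
      ⟨M, Set.forall_mem_range.2 fun y => Real.iSup_le (hb y) hM⟩
    have hle := le_ciSup hbdd x
    rw [ciSup_pos hx] at hle
    gcongr
end

section
/- Let N ≥ 1, let R : ℝ^N → ℝ^N be a C¹ vector field, and let K ⊂ ℝ^N be compact. Then sup over x ∈ K and unit vectors n ∈ ℝ^N of | ‖((I + δ DR(x))^{-1})^T n‖ − 1 + δ ⟨n, DR(x) n⟩ | = o(|δ|) as δ → 0, where A^T denotes the adjoint (transpose) of a linear endomorphism A of ℝ^N; here I + δ DR(x) is invertible for all x ∈ K once |δ| · sup_{x∈K} ‖DR(x)‖ < 1. -/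
open MeasureTheory Filter Topology Asymptotics
open scoped ENNReal NNReal RealInnerProductSpace

theorem isUnit_one_add_of_norm_lt_one {A : Type*} [NormedRing A] [HasSummableGeomSeries A]
    {a : A} (ha : ‖a‖ < 1) : IsUnit (1 + a) := by
  have h := isUnit_one_sub_of_norm_lt_one (x := -a) (by rwa [norm_neg])
  rwa [sub_neg_eq_add] at h

/-- First-order expansion of the norm of a perturbed unit vector. -/
theorem abs_norm_sub_sub_one_sub_inner_le {E : Type*} [NormedAddCommGroup E]
    [InnerProductSpace ℝ E] {n v : E} {ε : ℝ} (hn : ‖n‖ = 1) (hv : ‖v‖ ≤ ε) (hε : ε ≤ 1 / 2) :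
    |‖n - v‖ - (1 - ⟪n, v⟫)| ≤ 2 * ε ^ 2 := by
  have hsq : ‖n - v‖ ^ 2 = 1 - 2 * ⟪n, v⟫ + ‖v‖ ^ 2 := by
    rw [norm_sub_sq_real, hn]; ring
  have ht : |⟪n, v⟫| ≤ ε := by
    have := abs_real_inner_le_norm n v
    rw [hn, one_mul] at this
    exact this.trans hv
  have hp0 := norm_nonneg (n - v)
  have htsq : ⟪n, v⟫ ^ 2 ≤ ε ^ 2 := sq_le_sq' (abs_le.mp ht).1 (abs_le.mp ht).2
  have hvsq : ‖v‖ ^ 2 ≤ ε ^ 2 := by gcongr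
  have hlow : 1 / 2 ≤ ‖n - v‖ + (1 - ⟪n, v⟫) := by linarith [(abs_le.mp ht).2]
  have hprod : |‖n - v‖ - (1 - ⟪n, v⟫)| * (‖n - v‖ + (1 - ⟪n, v⟫)) ≤ ε ^ 2 := by
    rw [← abs_of_nonneg (show 0 ≤ ‖n - v‖ + (1 - ⟪n, v⟫) by linarith), ← abs_mul,
      show (‖n - v‖ - (1 - ⟪n, v⟫)) * (‖n - v‖ + (1 - ⟪n, v⟫)) = ‖v‖ ^ 2 - ⟪n, v⟫ ^ 2 by
        linear_combination hsq, abs_le]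
    constructor <;> nlinarith [sq_nonneg ‖v‖, sq_nonneg ⟪n, v⟫]
  nlinarith [abs_nonneg (‖n - v‖ - (1 - ⟪n, v⟫))]

/-- Quantitative first-order expansion of the norm of the inverse adjoint of `1 + B`
applied to a unit vector. -/
theorem abs_norm_adjoint_inverse_one_add_sub_le {E : Type*} [NormedAddCommGroup E]
    [InnerProductSpace ℝ E] [CompleteSpace E] {B : E →L[ℝ] E} {n : E} {ε : ℝ}
    (hn : ‖n‖ = 1) (hB : ‖B‖ ≤ ε) (hε : ε ≤ 1 / 2) :
    |‖ContinuousLinearMap.adjoint (Ring.inverse (1 + B)) n‖ - 1 + ⟪n, B n⟫| ≤ 4 * ε ^ 2 := by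
  have hunit : IsUnit (1 + B) := isUnit_one_add_of_norm_lt_one (by linarith)
  set m := ContinuousLinearMap.adjoint (Ring.inverse (1 + B)) n with hm
  set T := ContinuousLinearMap.adjoint B with hT
  have hTB : ‖T‖ ≤ ε := by rwa [hT, LinearIsometryEquiv.norm_map]
  have hε0 : 0 ≤ ε := (norm_nonneg B).trans hB
  have hmn : m + T m = n := by
    have h1 : ContinuousLinearMap.adjoint (Ring.inverse (1 + B) * (1 + B)) n = n := by
      rw [Ring.inverse_mul_cancel _ hunit, ← ContinuousLinearMap.star_eq_adjoint, star_one]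
      rfl
    rw [← ContinuousLinearMap.star_eq_adjoint, star_mul, star_add, star_one] at h1
    exact h1
  have hTle (w : E) : ‖T w‖ ≤ ε * ‖w‖ := T.le_of_opNorm_le hTB w
  have hm2 : ‖m‖ ≤ 2 := by
    have h1 : ‖m‖ ≤ ‖n‖ + ‖T m‖ := by
      conv_lhs => rw [eq_sub_of_add_eq hmn]
      exact norm_sub_le n (T m)
    nlinarith [hTle m, norm_nonneg m]
  have hr : ‖m - (n - T n)‖ ≤ 2 * ε ^ 2 := by
    have h1 : m - (n - T n) = T (T m) := by
      rw [← hmn, map_add]; abel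
    rw [h1]
    nlinarith [hTle (T m), mul_le_mul_of_nonneg_left (hTle m) hε0,
      mul_le_mul_of_nonneg_left hm2 (sq_nonneg ε)]
  have hdiff : |‖m‖ - ‖n - T n‖| ≤ 2 * ε ^ 2 := (abs_norm_sub_norm_le _ _).trans hr
  have hp := abs_norm_sub_sub_one_sub_inner_le hn
    (show ‖T n‖ ≤ ε by simpa [hn] using hTle n) hε
  rw [hT, ContinuousLinearMap.adjoint_inner_right, real_inner_comm, ← hT] at hp
  rw [abs_le] at *
  constructor <;> linarith [hp.1, hp.2, hdiff.1, hdiff.2]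

/-- For a `C¹` vector field `R` and a compact `K`,
`sup_{x ∈ K, ‖n‖ = 1} | ‖((I + δ DR(x))⁻¹)ᵀ n‖ − 1 + δ ⟨n, DR(x) n⟩ | = o(δ)`
as `δ → 0`, where `ᵀ` is the Euclidean adjoint (the inverse is taken in the
ring of continuous endomorphisms, with junk value `0` when not invertible);
moreover `I + δ DR(x)` is invertible for all `x ∈ K` once
`|δ| · sup_{x ∈ K} ‖DR(x)‖ < 1`. -/
theorem transpose_inverse_norm_expansion
    (N : ℕ) (hN : 1 ≤ N)
    (R : EuclideanSpace ℝ (Fin N) → EuclideanSpace ℝ (Fin N))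
    (hR : ContDiff ℝ 1 R)
    (K : Set (EuclideanSpace ℝ (Fin N))) (hK : IsCompact K) :
    ((fun δ : ℝ => ⨆ x ∈ K, ⨆ n ∈ Metric.sphere (0 : EuclideanSpace ℝ (Fin N)) 1,
        |‖ContinuousLinearMap.adjoint
            (Ring.inverse
              ((1 : EuclideanSpace ℝ (Fin N) →L[ℝ] EuclideanSpace ℝ (Fin N))
                + δ • fderiv ℝ R x)) n‖
          - 1 + δ * ⟪n, fderiv ℝ R x n⟫|)
      =o[𝓝 0] fun δ : ℝ => δ) ∧
    (∀ δ : ℝ, |δ| * (⨆ x ∈ K, ‖fderiv ℝ R x‖) < 1 → ∀ x ∈ K,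
      IsUnit ((1 : EuclideanSpace ℝ (Fin N) →L[ℝ] EuclideanSpace ℝ (Fin N))
        + δ • fderiv ℝ R x)) := by
  obtain ⟨M, hM⟩ := hK.exists_bound_of_continuousOn
    (hR.continuous_fderiv one_ne_zero).continuousOn
  refine ⟨?_, fun δ hδ x hx => ?_⟩
  · have hsmall : ∀ᶠ δ : ℝ in 𝓝 0, |δ| * |M| < 1 / 2 :=
      ContinuousAt.eventually_lt (by fun_prop) continuousAt_const (by simp)
    have hbig : (fun δ : ℝ => ⨆ x ∈ K, ⨆ n ∈ Metric.sphere (0 : EuclideanSpace ℝ (Fin N)) 1,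
        |‖ContinuousLinearMap.adjoint
            (Ring.inverse
              ((1 : EuclideanSpace ℝ (Fin N) →L[ℝ] EuclideanSpace ℝ (Fin N))
                + δ • fderiv ℝ R x)) n‖
          - 1 + δ * ⟪n, fderiv ℝ R x n⟫|) =O[𝓝 0] fun δ : ℝ => δ ^ 2 := by
      refine IsBigO.of_bound (4 * M ^ 2) ?_
      filter_upwards [hsmall] with δ hδ
      have hC : 0 ≤ 4 * M ^ 2 * ‖δ ^ 2‖ := by positivity
      rw [Real.norm_of_nonneg (Real.iSup_nonneg fun _ => Real.iSup_nonneg fun _ =>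
        Real.iSup_nonneg fun _ => Real.iSup_nonneg fun _ => abs_nonneg _)]
      refine Real.iSup_le (fun x => Real.iSup_le (fun hx => Real.iSup_le (fun n =>
        Real.iSup_le (fun hn => ?_) hC) hC) hC) hC
      have hB : ‖δ • fderiv ℝ R x‖ ≤ |δ| * |M| := by
        rw [norm_smul, Real.norm_eq_abs]
        gcongr
        exact (hM x hx).trans (le_abs_self M)
      have h := abs_norm_adjoint_inverse_one_add_sub_le (mem_sphere_zero_iff_norm.mp hn) hB hδ.le
      rw [smul_apply, real_inner_smul_right] at h
      refine h.trans_eq ?_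
      rw [mul_pow, sq_abs, sq_abs, Real.norm_of_nonneg (sq_nonneg δ)]
      ring
    exact hbig.trans_isLittleO (isLittleO_pow_id one_lt_two)
  · refine isUnit_one_add_of_norm_lt_one (lt_of_le_of_lt ?_ hδ)
    rw [norm_smul, Real.norm_eq_abs]
    gcongr
    have hbdd : BddAbove (Set.range fun y => ⨆ _ : y ∈ K, ‖fderiv ℝ R y‖) := by
      refine ⟨|M|, ?_⟩
      rintro _ ⟨y, rfl⟩
      exact Real.iSup_le (fun hy => (hM y hy).trans (le_abs_self M)) (abs_nonneg M)
    exact le_ciSup_of_le hbdd x (by rw [ciSup_pos hx])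
end

section
/- Let N ≥ 2, let Ω ⊂ ℝ^N be a bounded open set with 0 < H^{N-1}(∂Ω) < ∞, and let R : ℝ^N → ℝ^N be a C¹ vector field with bounded derivative. For δ small set Ω_δ := T_δ(Ω), where T_δ(x) = x + δ R(x); then Ω_δ is a bounded open set with ∂Ω_δ = T_δ(∂Ω) and 0 < H^{N-1}(∂Ω_δ) < ∞. Then λ₁(Ω_δ) → λ₁(Ω) as δ → 0. -/
open MeasureTheory Filter Topology
open scoped ENNReal NNReal

/-- The best constant in the trace embedding of `BV(D)` (equivalently `W^{1,1}(D)`)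
into `L^1(∂D)`, expressed as the infimum over Lipschitz functions `u : ℝ^N → ℝ`
with positive boundary integral of the quotient
`(∫_D ‖∇u‖ + ∫_D |u|) / ∫_{∂D} |u| dH^{N-1}`. -/
noncomputable def lambda1 {N : ℕ} (D : Set (EuclideanSpace ℝ (Fin N))) : ℝ :=
  sInf { c : ℝ | ∃ (u : EuclideanSpace ℝ (Fin N) → ℝ) (K : ℝ≥0), LipschitzWith K u ∧
      0 < ∫ x in frontier D, |u x| ∂(μH[(N : ℝ) - 1]) ∧
      c = ((∫ x in D, ‖fderiv ℝ u x‖) + ∫ x in D, |u x|) /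
            ∫ x in frontier D, |u x| ∂(μH[(N : ℝ) - 1]) }

/-- If `e` enlarges `μ` by at most the factor `C`, then the restriction of `μ` to `e '' D` is
dominated by `C` times the pushforward of the restriction of `μ` to `D`. -/
theorem Homeomorph.restrict_image_le_smul_map {X : Type*} [TopologicalSpace X]
    [MeasurableSpace X] [BorelSpace X] (e : X ≃ₜ X) {μ : Measure X} {C : ℝ≥0}
    (h : ∀ s, μ (e '' s) ≤ C * μ s) (D : Set X) :
    μ.restrict (e '' D) ≤ C • (μ.restrict D).map e := by
  refine Measure.le_iff.2 fun s hs => ?_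
  have hs' : MeasurableSet (e ⁻¹' s) := e.measurable hs
  have hsD : s ∩ e '' D = e '' (e ⁻¹' s ∩ D) := by
    rw [Set.inter_comm (e ⁻¹' s), Set.image_inter_preimage, Set.inter_comm]
  rw [Measure.restrict_apply hs, Measure.smul_apply, Measure.map_apply e.measurable hs,
    Measure.restrict_apply hs', hsD]
  exact h _

theorem Homeomorph.setIntegral_image_comp_symm_le {X : Type*} [TopologicalSpace X]
    [MeasurableSpace X] [BorelSpace X] (e : X ≃ₜ X) {μ : Measure X} {C : ℝ≥0}
    (h : ∀ s, μ (e '' s) ≤ C * μ s) {D : Set X} {f : X → ℝ} (hf : 0 ≤ f)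
    (hfD : IntegrableOn f D μ) :
    IntegrableOn (f ∘ e.symm) (e '' D) μ ∧
      ∫ y in e '' D, f (e.symm y) ∂μ ≤ C * ∫ x in D, f x ∂μ := by
  have hle := e.restrict_image_le_smul_map h D
  have hcomp : (f ∘ e.symm) ∘ e = f := by ext x; simp
  have hi : Integrable (f ∘ e.symm) (C • (μ.restrict D).map e) := by
    refine Integrable.smul_measure_nnreal ?_
    rw [e.measurableEmbedding.integrable_map_iff, hcomp]
    exact hfD
  refine ⟨hi.mono_measure hle, ?_⟩
  refine (integral_mono_measure hle (ae_of_all _ fun y => hf (e.symm y)) hi).trans_eq ?_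
  rw [integral_smul_nnreal_measure, e.measurableEmbedding.integral_map]
  simp [NNReal.smul_def]

theorem LipschitzWith.hausdorffMeasure_image_le_pow {X Y : Type*} [EMetricSpace X]
    [EMetricSpace Y] [MeasurableSpace X] [BorelSpace X] [MeasurableSpace Y] [BorelSpace Y]
    {f : X → Y} {L : ℝ≥0} (hf : LipschitzWith L f) (hL : 1 ≤ L) {d : ℝ} (hd : 0 ≤ d) {n : ℕ}
    (hdn : d ≤ n) (s : Set X) :
    μH[d] (f '' s) ≤ (L ^ n : ℝ≥0) * μH[d] s := by
  refine (hf.hausdorffMeasure_image_le hd s).trans ?_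
  gcongr
  rw [ENNReal.coe_pow, ← ENNReal.rpow_natCast]
  exact ENNReal.rpow_le_rpow_of_exponent_le (by exact_mod_cast hL) hdn

theorem LipschitzWith.volume_image_le_pow {N : ℕ}
    {f : EuclideanSpace ℝ (Fin N) → EuclideanSpace ℝ (Fin N)} {L : ℝ≥0} (hf : LipschitzWith L f)
    (s : Set (EuclideanSpace ℝ (Fin N))) :
    volume (f '' s) ≤ (L ^ N : ℝ≥0) * volume s := by
  have hv := Measure.isAddLeftInvariant_eq_smul (volume : Measure (EuclideanSpace ℝ (Fin N)))
    μH[Module.finrank ℝ (EuclideanSpace ℝ (Fin N))]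
  rw [hv, Measure.smul_apply, Measure.smul_apply, mul_smul_comm]
  gcongr
  simpa using hf.hausdorffMeasure_image_le (Nat.cast_nonneg N) s

/-- A bi-Lipschitz homeomorphism with constant `L` changes `lambda1` at most by the factor
`L ^ (2 * N + 1)`. -/
theorem lambda1_image_le {N : ℕ} (hN : 1 ≤ N) {L : ℝ≥0} (hL : 1 ≤ L)
    (e : EuclideanSpace ℝ (Fin N) ≃ₜ EuclideanSpace ℝ (Fin N)) (he : LipschitzWith L e)
    (he' : LipschitzWith L e.symm) {D : Set (EuclideanSpace ℝ (Fin N))}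
    (hDb : Bornology.IsBounded D) (hD0 : 0 < μH[(N : ℝ) - 1] (frontier D))
    (hD1 : μH[(N : ℝ) - 1] (frontier D) < ⊤) :
    lambda1 (e '' D) ≤ (L : ℝ) ^ (2 * N + 1) * lambda1 D := by
  have hL0 : (0 : ℝ) < L := lt_of_lt_of_le one_pos (by exact_mod_cast hL)
  have hL1 : (1 : ℝ) ≤ L := by exact_mod_cast hL
  have hN' : (1 : ℝ) ≤ N := by exact_mod_cast hN
  have hd0 : (0 : ℝ) ≤ (N : ℝ) - 1 := by linarith
  have hdN : (N : ℝ) - 1 ≤ (N : ℕ) := by linarith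
  have hcpt : IsCompact (frontier D) :=
    Metric.isCompact_of_isClosed_isBounded isClosed_frontier
      (hDb.closure.subset frontier_subset_closure)
  have hfin : μH[(N : ℝ) - 1] (frontier (e '' D)) < ⊤ := by
    rw [← e.image_frontier]
    exact (he.hausdorffMeasure_image_le_pow hL hd0 hdN _).trans_lt
      (ENNReal.mul_lt_top ENNReal.coe_lt_top hD1)
  have hintF : ∀ {A : Set (EuclideanSpace ℝ (Fin N))}, IsCompact A →
      μH[(N : ℝ) - 1] A < ⊤ → ∀ {w : EuclideanSpace ℝ (Fin N) → ℝ}, Continuous w →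
      IntegrableOn w A μH[(N : ℝ) - 1] := fun hA hA' _ hw =>
    hw.continuousOn.integrableOn_of_subset_isCompact hA hA.measurableSet subset_rfl hA'.ne
  have hne : { c : ℝ | ∃ (u : EuclideanSpace ℝ (Fin N) → ℝ) (K : ℝ≥0), LipschitzWith K u ∧
      0 < ∫ x in frontier D, |u x| ∂(μH[(N : ℝ) - 1]) ∧
      c = ((∫ x in D, ‖fderiv ℝ u x‖) + ∫ x in D, |u x|) /
            ∫ x in frontier D, |u x| ∂(μH[(N : ℝ) - 1]) }.Nonempty := by
    refine ⟨_, fun _ => 1, 0, LipschitzWith.const 1, ?_, rfl⟩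
    simpa [Measure.real] using ENNReal.toReal_pos hD0.ne' hD1.ne
  rw [mul_comm, ← div_le_iff₀ (by positivity)]
  refine le_csInf hne ?_
  rintro _ ⟨u, K, hu, hpos, rfl⟩
  rw [div_le_iff₀ (by positivity)]
  set v : EuclideanSpace ℝ (Fin N) → ℝ := u ∘ e.symm with hv
  have hvL : LipschitzWith (K * L) v := hu.comp he'
  have hbd : ∫ x in frontier D, |u x| ∂(μH[(N : ℝ) - 1]) ≤
      (L : ℝ) ^ N * ∫ y in frontier (e '' D), |v y| ∂(μH[(N : ℝ) - 1]) := by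
    have := (e.symm.setIntegral_image_comp_symm_le (f := fun y => |v y|)
      (he'.hausdorffMeasure_image_le_pow hL hd0 hdN) (fun y => abs_nonneg _)
      (hintF (A := frontier (e '' D)) (e.image_frontier D ▸ hcpt.image e.continuous)
        hfin hvL.continuous.abs)).2
    rw [← e.image_frontier] at this ⊢
    simpa [hv, Set.image_image] using this
  have hpos' : 0 < ∫ y in frontier (e '' D), |v y| ∂(μH[(N : ℝ) - 1]) :=
    pos_of_mul_pos_right (hpos.trans_le hbd) (by positivity)
  have hDfin : volume D < ⊤ := hDb.measure_lt_top
  have hu1 : IntegrableOn (fun x => |u x|) D volume :=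
    (hu.continuous.abs.continuousOn.integrableOn_compact hDb.isCompact_closure).mono_set
      subset_closure
  have hu2 : IntegrableOn (fun x => ‖fderiv ℝ u x‖) D volume := by
    refine Measure.integrableOn_of_bounded (M := K) hDfin.ne
      (measurable_fderiv ℝ u).norm.aestronglyMeasurable (ae_of_all _ fun x => ?_)
    simpa using norm_fderiv_le_of_lipschitz ℝ hu
  have hv1 := (e.setIntegral_image_comp_symm_le (μ := volume) he.volume_image_le_pow
    (f := fun x => |u x|) (fun y => abs_nonneg _) hu1).2
  have hv2 := e.setIntegral_image_comp_symm_le (μ := volume) he.volume_image_le_pow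
    (f := fun x => ‖fderiv ℝ u x‖) (fun y => norm_nonneg _) hu2
  have hac : ∀ᵐ y : EuclideanSpace ℝ (Fin N), DifferentiableAt ℝ u (e.symm y) := by
    have h0 : volume (e '' {x | ¬ DifferentiableAt ℝ u x}) = 0 := by
      refine nonpos_iff_eq_zero.1 ((he.volume_image_le_pow _).trans_eq ?_)
      rw [ae_iff.1 hu.ae_differentiableAt, mul_zero]
    rw [ae_iff]
    convert h0 using 2
    ext y
    simp [e.image_eq_preimage_symm]
  have hgrad : ∀ᵐ y : EuclideanSpace ℝ (Fin N),
      ‖fderiv ℝ v y‖ ≤ L * ‖fderiv ℝ u (e.symm y)‖ := by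
    filter_upwards [hac, he'.ae_differentiableAt] with y h1 h2
    rw [hv, fderiv_comp y h1 h2, mul_comm]
    refine (ContinuousLinearMap.opNorm_comp_le _ _).trans ?_
    gcongr
    exact norm_fderiv_le_of_lipschitz ℝ he'
  have hv3 : ∫ y in e '' D, ‖fderiv ℝ v y‖ ≤ L * ((L : ℝ) ^ N * ∫ x in D, ‖fderiv ℝ u x‖) := by
    calc ∫ y in e '' D, ‖fderiv ℝ v y‖
        ≤ ∫ y in e '' D, L * ‖fderiv ℝ u (e.symm y)‖ :=
          integral_mono_of_nonneg (ae_of_all _ fun y => norm_nonneg _)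
            (hv2.1.const_mul (L : ℝ)) (ae_restrict_of_ae hgrad)
      _ = L * ∫ y in e '' D, ‖fderiv ℝ u (e.symm y)‖ := integral_const_mul _ _
      _ ≤ _ := by
        gcongr
        simpa using hv2.2
  have hnum : (∫ y in e '' D, ‖fderiv ℝ v y‖) + ∫ y in e '' D, |v y| ≤
      (L : ℝ) ^ (N + 1) * ((∫ x in D, ‖fderiv ℝ u x‖) + ∫ x in D, |u x|) := by
    have h1 : ∫ y in e '' D, |v y| ≤ (L : ℝ) ^ (N + 1) * ∫ x in D, |u x| := by
      refine le_trans (by simpa [hv] using hv1) ?_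
      gcongr
      exact Nat.le_succ N
    rw [mul_add]
    refine add_le_add (hv3.trans_eq ?_) h1
    ring
  have hnn : 0 ≤ (∫ x in D, ‖fderiv ℝ u x‖) + ∫ x in D, |u x| := by positivity
  have hmem : lambda1 (e '' D) ≤ ((∫ y in e '' D, ‖fderiv ℝ v y‖) + ∫ y in e '' D, |v y|) /
      ∫ y in frontier (e '' D), |v y| ∂(μH[(N : ℝ) - 1]) := by
    refine csInf_le ⟨0, ?_⟩ ⟨v, K * L, hvL, hpos', rfl⟩
    rintro _ ⟨w, _, _, _, rfl⟩
    positivity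
  refine hmem.trans ?_
  rw [div_mul_eq_mul_div, div_le_div_iff₀ hpos' hpos]
  calc _ ≤ ((L : ℝ) ^ (N + 1) * ((∫ x in D, ‖fderiv ℝ u x‖) + ∫ x in D, |u x|)) *
        ((L : ℝ) ^ N * ∫ y in frontier (e '' D), |v y| ∂(μH[(N : ℝ) - 1])) :=
        mul_le_mul hnum hbd hpos.le (by positivity)
    _ = _ := by ring

/-- A perturbation of the identity by a `c`-Lipschitz map with `c < 1` is a homeomorphism which is
bi-Lipschitz with constant `(1 - c)⁻¹`. -/
theorem LipschitzWith.exists_homeomorph_id_add {E : Type*} [NormedAddCommGroup E]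
    [NormedSpace ℝ E] [CompleteSpace E] {g : E → E} {c : ℝ≥0} (hg : LipschitzWith c g)
    (hc : c < 1) :
    ∃ e : E ≃ₜ E, ⇑e = (fun x => x + g x) ∧ LipschitzWith (1 - c)⁻¹ e ∧
      LipschitzWith (1 - c)⁻¹ e.symm := by
  have hanti : AntilipschitzWith (1 - c)⁻¹ (fun x => x + g x) := by
    simpa using AntilipschitzWith.id.add_lipschitzWith hg (by simpa using hc)
  have hlip : LipschitzWith (1 - c)⁻¹ (fun x => x + g x) := by
    refine (LipschitzWith.id.add hg).weaken ?_
    rw [← NNReal.coe_le_coe]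
    have h1 : (c : ℝ) < 1 := by exact_mod_cast hc
    rw [NNReal.coe_inv, NNReal.coe_sub hc.le, ← one_div, le_div_iff₀ (by simpa using h1)]
    push_cast
    nlinarith [sq_nonneg (c : ℝ)]
  have happ : ApproximatesLinearOn (fun x => x + g x)
      (ContinuousLinearEquiv.refl ℝ E : E →L[ℝ] E) Set.univ c := by
    intro x _ y _
    simpa [add_sub_add_comm, dist_eq_norm] using hg.dist_le_mul x y
  have hsurj : Function.Surjective (fun x => x + g x) := by
    rcases subsingleton_or_nontrivial E with hE | hE
    · exact happ.surjective (Or.inl hE)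
    · refine happ.surjective (Or.inr ?_)
      have : ‖((ContinuousLinearEquiv.refl ℝ E).symm : E →L[ℝ] E)‖₊ = 1 :=
        ContinuousLinearMap.nnnorm_id
      rw [this, inv_one]
      exact hc
  let f := Equiv.ofBijective _ ⟨hanti.injective, hsurj⟩
  have hinv : LipschitzWith (1 - c)⁻¹ f.symm := hanti.to_rightInverse f.apply_symm_apply
  exact ⟨⟨f, hlip.continuous, hinv.continuous⟩, rfl, hlip, hinv⟩

/-- For a `C¹` vector field `R` with bounded derivative and `T_δ(x) = x + δ R(x)`,
the perturbed domain `Ω_δ = T_δ(Ω)` is (for small `δ`) a bounded open set with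
`∂Ω_δ = T_δ(∂Ω)` and `0 < H^{N-1}(∂Ω_δ) < ∞`, and `λ₁(Ω_δ) → λ₁(Ω)` as `δ → 0`. -/
theorem lambda1_continuous_under_perturbation
    (N : ℕ) (hN : 2 ≤ N) (Ω : Set (EuclideanSpace ℝ (Fin N)))
    (hΩo : IsOpen Ω) (hΩb : Bornology.IsBounded Ω)
    (hH0 : 0 < μH[(N : ℝ) - 1] (frontier Ω))
    (hH1 : μH[(N : ℝ) - 1] (frontier Ω) < ⊤)
    (R : EuclideanSpace ℝ (Fin N) → EuclideanSpace ℝ (Fin N))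
    (hR : ContDiff ℝ 1 R)
    (hRb : ∃ M : ℝ, ∀ x, ‖fderiv ℝ R x‖ ≤ M) :
    (∀ᶠ δ : ℝ in 𝓝 0,
        IsOpen ((fun x => x + δ • R x) '' Ω) ∧
        Bornology.IsBounded ((fun x => x + δ • R x) '' Ω) ∧
        frontier ((fun x => x + δ • R x) '' Ω) = (fun x => x + δ • R x) '' frontier Ω ∧
        0 < μH[(N : ℝ) - 1] (frontier ((fun x => x + δ • R x) '' Ω)) ∧
        μH[(N : ℝ) - 1] (frontier ((fun x => x + δ • R x) '' Ω)) < ⊤) ∧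
    Tendsto (fun δ : ℝ => lambda1 ((fun x => x + δ • R x) '' Ω))
      (𝓝 0) (𝓝 (lambda1 Ω)) := by
  obtain ⟨M, hM⟩ := hRb
  have hRL : LipschitzWith M.toNNReal R :=
    lipschitzWith_of_nnnorm_fderiv_le (hR.differentiable one_ne_zero) fun x => by
      rw [← norm_toNNReal]
      exact Real.toNNReal_le_toNNReal (hM x)
  set c : ℝ → ℝ≥0 := fun δ => ‖δ‖₊ * M.toNNReal with hc
  set L : ℝ → ℝ≥0 := fun δ => (1 - c δ)⁻¹ with hLdef
  have hcc : Continuous c := by fun_prop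
  have hc0 : c 0 = 0 := by simp [hc]
  have hclt : ∀ᶠ δ in 𝓝 0, c δ < 1 :=
    hcc.continuousAt.eventually_lt continuousAt_const (by simp [hc0])
  have hLt : Tendsto (fun δ => (L δ : ℝ)) (𝓝 0) (𝓝 1) := by
    have h : Tendsto L (𝓝 0) (𝓝 (1 - c 0)⁻¹) :=
      Tendsto.inv₀ (tendsto_const_nhds.sub (hcc.tendsto 0)) (by simp [hc0])
    rw [hc0, tsub_zero, inv_one] at h
    exact NNReal.tendsto_coe.2 h
  have hd0 : (0 : ℝ) ≤ (N : ℝ) - 1 := by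
    have : (2 : ℝ) ≤ N := by exact_mod_cast hN
    linarith
  have key : ∀ᶠ δ : ℝ in 𝓝 0, 1 ≤ L δ ∧ ∃ e : EuclideanSpace ℝ (Fin N) ≃ₜ EuclideanSpace ℝ (Fin N),
      ⇑e = (fun x => x + δ • R x) ∧ LipschitzWith (L δ) e ∧ LipschitzWith (L δ) e.symm := by
    filter_upwards [hclt] with δ hδ
    refine ⟨?_, ((lipschitzWith_smul δ).comp hRL).exists_homeomorph_id_add hδ⟩
    exact (one_le_inv₀ (tsub_pos_of_lt hδ)).2 tsub_le_self
  have hgeom : ∀ᶠ δ : ℝ in 𝓝 0,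
      IsOpen ((fun x => x + δ • R x) '' Ω) ∧
      Bornology.IsBounded ((fun x => x + δ • R x) '' Ω) ∧
      frontier ((fun x => x + δ • R x) '' Ω) = (fun x => x + δ • R x) '' frontier Ω ∧
      0 < μH[(N : ℝ) - 1] (frontier ((fun x => x + δ • R x) '' Ω)) ∧
      μH[(N : ℝ) - 1] (frontier ((fun x => x + δ • R x) '' Ω)) < ⊤ := by
    filter_upwards [key] with δ ⟨hL1, e, hcoe, he, he'⟩
    rw [← hcoe, ← e.image_frontier]
    refine ⟨e.isOpenMap _ hΩo, he.isBounded_image hΩb, rfl, ?_, ?_⟩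
    · refine pos_iff_ne_zero.2 fun h0 => hH0.ne' ?_
      have h := he'.hausdorffMeasure_image_le hd0 (e '' frontier Ω)
      rw [h0, mul_zero, Set.image_image] at h
      simpa using h
    · exact (he.hausdorffMeasure_image_le hd0 _).trans_lt
        (ENNReal.mul_lt_top (ENNReal.rpow_lt_top_of_nonneg hd0 ENNReal.coe_ne_top) hH1)
  refine ⟨hgeom, ?_⟩
  have hpow : Tendsto (fun δ => (L δ : ℝ) ^ (2 * N + 1)) (𝓝 0) (𝓝 1) := by
    simpa using hLt.pow (2 * N + 1)
  have hup : Tendsto (fun δ => (L δ : ℝ) ^ (2 * N + 1) * lambda1 Ω) (𝓝 0) (𝓝 (lambda1 Ω)) := by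
    simpa using hpow.mul_const (lambda1 Ω)
  have hlow : Tendsto (fun δ => lambda1 Ω / (L δ : ℝ) ^ (2 * N + 1)) (𝓝 0) (𝓝 (lambda1 Ω)) := by
    have h := (tendsto_const_nhds (x := lambda1 Ω)).div hpow one_ne_zero
    rwa [div_one] at h
  refine tendsto_of_tendsto_of_tendsto_of_le_of_le' hlow hup ?_ ?_
  · filter_upwards [key, hgeom] with δ ⟨hL1, e, hcoe, he, he'⟩ ⟨_, hb, _, h0, h1⟩
    have hpos : (0 : ℝ) < L δ := lt_of_lt_of_le one_pos (by exact_mod_cast hL1)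
    rw [div_le_iff₀ (by positivity), mul_comm]
    rw [← hcoe] at hb h0 h1 ⊢
    have h := lambda1_image_le (one_le_two.trans hN) hL1 e.symm he' he hb h0 h1
    simpa [Set.image_image] using h
  · filter_upwards [key] with δ ⟨hL1, e, hcoe, he, he'⟩
    rw [← hcoe]
    exact lambda1_image_le (one_le_two.trans hN) hL1 e he he' hΩb hH0 hH1
end

section
/- Let N ≥ 2 and let Q = [0,1]^N be the unit cube of ℝ^N. For δ, η ∈ (0,1) let A_{δ,η} := [1, 1+η] × [0,δ] × [0,1]^{N-2} and let Q_{δ,η} be the interior of Q ∪ A_{δ,η}. Then λ₁(Q_{δ,η}) ≤ δ(1+η)/(2η). In particular, for fixed η, λ₁(Q_{δ,η}) → 0 as δ → 0⁺, even though the Lebesgue measure of the symmetric difference Q_{δ,η} Δ int(Q) tends to 0; thus λ₁ is not continuous with respect to convergence of domains in measure. -/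
open MeasureTheory Filter Topology
open scoped ENNReal NNReal symmDiff

/-- The unit cube `Q = [0,1]^N`. -/
def unitCube (N : ℕ) : Set (EuclideanSpace ℝ (Fin N)) :=
  {x | ∀ i, x i ∈ Set.Icc (0 : ℝ) 1}

/-- The thin appendix `A_{δ,η} = [1,1+η] × [0,δ] × [0,1]^{N-2}`. -/
def appendixSet (N : ℕ) (hN : 2 ≤ N) (δ η : ℝ) : Set (EuclideanSpace ℝ (Fin N)) :=
  {x | x ⟨0, by omega⟩ ∈ Set.Icc (1 : ℝ) (1 + η) ∧
       x ⟨1, by omega⟩ ∈ Set.Icc (0 : ℝ) δ ∧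
       ∀ i : Fin N, 2 ≤ (i : ℕ) → x i ∈ Set.Icc (0 : ℝ) 1}

/-- The closed coordinate box `∏ i, [a i, b i]`. -/
def coordBox {ι : Type*} (a b : ι → ℝ) : Set (EuclideanSpace ℝ ι) :=
  {x | ∀ i, x i ∈ Set.Icc (a i) (b i)}

/-- The part of the box `∏ i, [a i, b i]` in the hyperplane `x i = c`. -/
def boxSlice {ι : Type*} (a b : ι → ℝ) (i : ι) (c : ℝ) : Set (EuclideanSpace ℝ ι) :=
  {x | x ∈ coordBox a b ∧ x i = c}

section Box

variable {ι : Type*} {a b : ι → ℝ}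

lemma coordBox_eq_preimage : coordBox a b = WithLp.ofLp ⁻¹' Set.Icc a b := by
  ext x
  simp [coordBox, Set.mem_Icc, Pi.le_def, forall_and]

lemma isClosed_coordBox : IsClosed (coordBox a b) := by
  rw [coordBox_eq_preimage]
  exact isClosed_Icc.preimage (PiLp.continuous_ofLp 2 _)

lemma isClosed_boxSlice (i : ι) (c : ℝ) : IsClosed (boxSlice a b i c) :=
  isClosed_coordBox.inter (isClosed_eq (by fun_prop) continuous_const)

lemma convex_coordBox : Convex ℝ (coordBox a b) := by
  rw [coordBox_eq_preimage]
  exact (convex_Icc a b).linear_preimage (WithLp.linearEquiv 2 ℝ (ι → ℝ)).toLinearMap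

variable [Fintype ι]

lemma volume_coordBox :
    volume (coordBox a b) = ∏ i, ENNReal.ofReal (b i - a i) := by
  rw [coordBox_eq_preimage, (PiLp.volume_preserving_ofLp ι).measure_preimage
    measurableSet_Icc.nullMeasurableSet, Real.volume_Icc_pi]

lemma volume_coordBox_lt_top : volume (coordBox a b) < ∞ := by
  rw [volume_coordBox]
  exact ENNReal.prod_lt_top fun _ _ => ENNReal.ofReal_lt_top

lemma isOpen_openCoordBox :
    IsOpen {x : EuclideanSpace ℝ ι | ∀ i, a i < x i ∧ x i < b i} := by
  simp only [Set.ofPred_forall]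
  refine isOpen_iInter_of_finite fun i => ?_
  have hi : Continuous fun x : EuclideanSpace ℝ ι => x i := by fun_prop
  exact (isOpen_lt continuous_const hi).inter (isOpen_lt hi continuous_const)

lemma openCoordBox_subset_interior :
    {x : EuclideanSpace ℝ ι | ∀ i, a i < x i ∧ x i < b i} ⊆ interior (coordBox a b) :=
  interior_maximal (fun _ hx i => ⟨(hx i).1.le, (hx i).2.le⟩) isOpen_openCoordBox

lemma closure_interior_coordBox (h : ∀ i, a i < b i) :
    closure (interior (coordBox a b)) = coordBox a b := by
  rw [convex_coordBox.closure_interior_eq_closure_of_nonempty_interior,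
    isClosed_coordBox.closure_eq]
  refine ⟨WithLp.toLp 2 fun i => (a i + b i) / 2, openCoordBox_subset_interior fun i => ?_⟩
  have := h i
  constructor <;> simp only <;> linarith

lemma frontier_coordBox_subset :
    frontier (coordBox a b) ⊆ ⋃ i, boxSlice a b i (a i) ∪ boxSlice a b i (b i) := by
  intro x hx
  have hxb : x ∈ coordBox a b := isClosed_coordBox.frontier_subset hx
  have hxi : ¬ ∀ i, a i < x i ∧ x i < b i := fun h => hx.2 (openCoordBox_subset_interior h)
  push Not at hxi
  obtain ⟨i, hi⟩ := hxi
  refine Set.mem_iUnion.2 ⟨i, ?_⟩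
  rcases (hxb i).1.eq_or_lt with h | h
  · exact Or.inl ⟨hxb, h.symm⟩
  · exact Or.inr ⟨hxb, le_antisymm (hxb i).2 (hi h)⟩

lemma hausdorffMeasure_pi_Icc {n : ℕ} (a b : Fin n → ℝ) :
    μH[(n : ℝ)] (Set.Icc a b) = ∏ i, ENNReal.ofReal (b i - a i) := by
  rw [← Real.volume_Icc_pi, ← hausdorffMeasure_pi_real, Fintype.card_fin]

end Box

section Slice

variable {n : ℕ} {a b : Fin (n + 1) → ℝ}

lemma hausdorffMeasure_boxSlice_lt_top (i : Fin (n + 1)) (c : ℝ) :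
    μH[(n : ℝ)] (boxSlice a b i c) < ∞ := by
  set f : (Fin n → ℝ) → EuclideanSpace ℝ (Fin (n + 1)) :=
    fun y => WithLp.toLp 2 (i.insertNth c y) with hf
  have hins : LipschitzWith 1 fun y : Fin n → ℝ => (i.insertNth c y : Fin (n + 1) → ℝ) := by
    refine LipschitzWith.of_dist_le_mul fun x y => ?_
    rw [NNReal.coe_one, one_mul, dist_pi_le_iff dist_nonneg]
    intro j
    refine Fin.succAboveCases i ?_ (fun k => ?_) j
    · simp
    · simpa using dist_le_pi_dist x y k
  have hlip := (PiLp.lipschitzWith_toLp 2 fun _ : Fin (n + 1) => ℝ).comp hins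
  have hsub : boxSlice a b i c ⊆
      f '' Set.Icc (fun k => a (i.succAbove k)) (fun k => b (i.succAbove k)) := by
    rintro x ⟨hx, rfl⟩
    refine ⟨fun k => x (i.succAbove k), ⟨fun k => (hx _).1, fun k => (hx _).2⟩, ?_⟩
    ext j
    refine Fin.succAboveCases i ?_ (fun k => ?_) j <;> simp [hf]
  refine (measure_mono hsub).trans_lt ((hlip.hausdorffMeasure_image_le n.cast_nonneg _).trans_lt ?_)
  rw [hausdorffMeasure_pi_Icc]
  exact ENNReal.mul_lt_top (ENNReal.rpow_lt_top_of_nonneg n.cast_nonneg ENNReal.coe_ne_top)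
    (ENNReal.prod_lt_top fun _ _ => ENNReal.ofReal_lt_top)

lemma prod_le_hausdorffMeasure_boxSlice (i : Fin (n + 1)) {c : ℝ}
    (hc : c ∈ Set.Icc (a i) (b i)) :
    ∏ k, ENNReal.ofReal (b (i.succAbove k) - a (i.succAbove k)) ≤
      μH[(n : ℝ)] (boxSlice a b i c) := by
  have hrem : LipschitzWith 1 fun x : EuclideanSpace ℝ (Fin (n + 1)) =>
      fun k : Fin n => x (i.succAbove k) := by
    refine LipschitzWith.of_dist_le_mul fun x y => ?_
    rw [NNReal.coe_one, one_mul, dist_pi_le_iff dist_nonneg]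
    intro k
    exact (dist_le_pi_dist x.ofLp y.ofLp _).trans
      (by simpa using (PiLp.lipschitzWith_ofLp 2 fun _ : Fin (n + 1) => ℝ).dist_le_mul x y)
  rw [← hausdorffMeasure_pi_Icc]
  have hsub : Set.Icc (fun k => a (i.succAbove k)) (fun k => b (i.succAbove k)) ⊆
      (fun x : EuclideanSpace ℝ (Fin (n + 1)) => fun k : Fin n => x (i.succAbove k)) ''
        boxSlice a b i c := by
    intro y hy
    refine ⟨WithLp.toLp 2 (i.insertNth c y), ⟨fun j => ?_, by simp⟩, by ext; simp⟩
    refine Fin.succAboveCases i ?_ (fun k => ?_) j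
    · simpa using hc
    · simpa using ⟨hy.1 k, hy.2 k⟩
  refine (measure_mono hsub).trans ((hrem.hausdorffMeasure_image_le n.cast_nonneg _).trans ?_)
  simp

lemma hausdorffMeasure_frontier_coordBox_lt_top :
    μH[(n : ℝ)] (frontier (coordBox a b)) < ∞ := by
  refine (measure_mono frontier_coordBox_subset).trans_lt ?_
  refine (measure_iUnion_le _).trans_lt ?_
  rw [tsum_fintype]
  refine ENNReal.sum_lt_top.2 fun i _ => (measure_union_le _ _).trans_lt ?_
  exact ENNReal.add_lt_top.2
    ⟨hausdorffMeasure_boxSlice_lt_top _ _, hausdorffMeasure_boxSlice_lt_top _ _⟩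

end Slice

/-- The box `[s, t] × [0, δ] × [0, 1]^n`. -/
def slab (n : ℕ) (s t δ : ℝ) : Set (EuclideanSpace ℝ (Fin (n + 2))) :=
  coordBox (Fin.cons s 0) (Fin.cons t (Fin.cons δ 1))

section Slab

variable {n : ℕ} {s t δ η : ℝ}

lemma mem_slab {x : EuclideanSpace ℝ (Fin (n + 2))} :
    x ∈ slab n s t δ ↔ x 0 ∈ Set.Icc s t ∧ x 1 ∈ Set.Icc 0 δ ∧
      ∀ i : Fin n, x i.succ.succ ∈ Set.Icc (0 : ℝ) 1 := by
  simp only [slab, coordBox, Set.mem_ofPred_eq, Fin.forall_fin_succ (n := n + 1),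
    Fin.forall_fin_succ (n := n), Fin.cons_zero, Fin.cons_succ, Pi.zero_apply, Pi.one_apply,
    Fin.succ_zero_eq_one]

lemma unitCube_eq_slab : unitCube (n + 2) = slab n 0 1 1 := by
  ext x
  simp only [mem_slab, unitCube, Set.mem_ofPred_eq, Fin.forall_fin_succ (n := n + 1),
    Fin.forall_fin_succ (n := n), Fin.succ_zero_eq_one]

lemma appendixSet_eq_slab (h : 2 ≤ n + 2) :
    appendixSet (n + 2) h δ η = slab n 1 (1 + η) δ := by
  ext x
  rw [mem_slab]
  refine and_congr_right' (and_congr_right' ⟨fun hx i => hx _ (by simp), fun hx i hi => ?_⟩)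
  obtain ⟨j, rfl⟩ : ∃ j : Fin n, j.succ.succ = i :=
    ⟨⟨i - 2, by omega⟩, Fin.ext (by simp; omega)⟩
  exact hx j

lemma volume_slab : volume (slab n s t δ) = ENNReal.ofReal (t - s) * ENNReal.ofReal δ := by
  rw [slab, volume_coordBox]
  simp [Fin.prod_univ_succ]

/-- The closed set whose interior is the perturbed cube. -/
def cubeWithSlab (n : ℕ) (δ η : ℝ) : Set (EuclideanSpace ℝ (Fin (n + 2))) :=
  slab n 0 1 1 ∪ slab n 1 (1 + η) δ

lemma hausdorffMeasure_frontier_lt_top :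
    μH[((n + 1 : ℕ) : ℝ)] (frontier (interior (cubeWithSlab n δ η))) < ∞ := by
  have hsub : frontier (interior (cubeWithSlab n δ η)) ⊆
      frontier (slab n 0 1 1) ∪ frontier (slab n 1 (1 + η) δ) :=
    frontier_interior_subset.trans ((frontier_union_subset _ _).trans
      (Set.union_subset_union Set.inter_subset_left Set.inter_subset_right))
  exact (measure_mono hsub).trans_lt ((measure_union_le _ _).trans_lt (ENNReal.add_lt_top.2
    ⟨hausdorffMeasure_frontier_coordBox_lt_top, hausdorffMeasure_frontier_coordBox_lt_top⟩))

lemma apply_one_of_mem_interior {x : EuclideanSpace ℝ (Fin (n + 2))}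
    (hx : x ∈ interior (cubeWithSlab n δ η)) (h1 : 1 < x 0) : x 1 ∈ Set.Ioo 0 δ := by
  have h0c : Continuous fun x : EuclideanSpace ℝ (Fin (n + 2)) => x 0 := by fun_prop
  have hopen : IsOpenMap fun x : EuclideanSpace ℝ (Fin (n + 2)) => x 1 :=
    (EuclideanSpace.proj (𝕜 := ℝ) (1 : Fin (n + 2))).isOpenMap fun c =>
      ⟨WithLp.toLp 2 fun _ => c, rfl⟩
  have hU : IsOpen (interior (cubeWithSlab n δ η) ∩ {x | 1 < x 0}) :=
    isOpen_interior.inter (isOpen_lt continuous_const h0c)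
  have hmaps : (fun x : EuclideanSpace ℝ (Fin (n + 2)) => x 1) ''
      (interior (cubeWithSlab n δ η) ∩ {x | 1 < x 0}) ⊆ Set.Icc 0 δ := by
    rintro _ ⟨y, ⟨hy, hy1⟩, rfl⟩
    rcases interior_subset hy with hy | hy
    · exact absurd (mem_slab.1 hy).1.2 (not_le.2 hy1)
    · exact (mem_slab.1 hy).2.1
  have := interior_maximal hmaps (hopen _ hU) ⟨x, ⟨hx, h1⟩, rfl⟩
  rwa [interior_Icc] at this

lemma slab_subset_closure (hη : 0 < η) (hδ : 0 < δ) :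
    slab n 1 (1 + η) δ ⊆ closure (interior (cubeWithSlab n δ η)) := by
  have h : ∀ i : Fin (n + 2), (Fin.cons 1 0 : Fin (n + 2) → ℝ) i <
      (Fin.cons (1 + η) (Fin.cons δ 1) : Fin (n + 2) → ℝ) i := by
    refine Fin.cases (by simpa using hη) (Fin.cases (by simpa using hδ) fun i => by simp)
  calc slab n 1 (1 + η) δ = closure (interior (slab n 1 (1 + η) δ)) :=
        (closure_interior_coordBox h).symm
    _ ⊆ _ := closure_mono (interior_mono Set.subset_union_right)

/-- The face `[s, 1 + η] × {c} × [0, 1]^n` of the appendix. -/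
def slabFace (n : ℕ) (s η δ c : ℝ) : Set (EuclideanSpace ℝ (Fin (n + 2))) :=
  boxSlice (Fin.cons s 0) (Fin.cons (1 + η) (Fin.cons δ 1)) 1 c

lemma slabFace_subset_frontier (hη : 0 < η) (hδ : 0 < δ) (hs : 1 < s) {c : ℝ}
    (hc : c ∉ Set.Ioo 0 δ) :
    slabFace n s η δ c ⊆ frontier (interior (cubeWithSlab n δ η)) := by
  rintro x ⟨hx, rfl⟩
  have hx' := mem_slab.1 hx
  refine ⟨slab_subset_closure hη hδ (mem_slab.2 ⟨⟨hs.le.trans hx'.1.1, hx'.1.2⟩, hx'.2⟩), ?_⟩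
  rw [interior_interior]
  exact fun h => hc (apply_one_of_mem_interior h (hs.trans_le hx'.1.1))

lemma sub_le_hausdorffMeasure_slabFace {c : ℝ} (hc : c ∈ Set.Icc 0 δ) :
    ENNReal.ofReal (1 + η - s) ≤ μH[((n + 1 : ℕ) : ℝ)] (slabFace n s η δ c) := by
  have h := prod_le_hausdorffMeasure_boxSlice (a := (Fin.cons s 0 : Fin (n + 2) → ℝ))
    (b := Fin.cons (1 + η) (Fin.cons δ 1)) 1 (c := c) hc
  refine le_trans (le_of_eq ?_) h
  rw [Fin.prod_univ_succ]
  have : ∀ k : Fin n, (1 : Fin (n + 2)).succAbove k.succ = k.succ.succ := fun k => by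
    rw [← Fin.succ_zero_eq_one, Fin.succ_succAbove_succ, Fin.succAbove_zero]
  simp [this]

end Slab

section Ramp

variable {n : ℕ} {δ η ε : ℝ}

/-- The function of the first coordinate increasing linearly from `0` to `1` on `[1, 1 + ε]`. -/
noncomputable def ramp (n : ℕ) (ε : ℝ) (x : EuclideanSpace ℝ (Fin (n + 2))) : ℝ :=
  max 0 (min 1 (ε⁻¹ * (x 0 - 1)))

lemma ramp_nonneg (x : EuclideanSpace ℝ (Fin (n + 2))) : 0 ≤ ramp n ε x := le_max_left _ _

lemma ramp_le_one (x : EuclideanSpace ℝ (Fin (n + 2))) : ramp n ε x ≤ 1 :=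
  max_le zero_le_one (min_le_left _ _)

lemma abs_ramp (x : EuclideanSpace ℝ (Fin (n + 2))) : |ramp n ε x| = ramp n ε x :=
  abs_of_nonneg (ramp_nonneg x)

lemma ramp_eq_zero (hε : 0 < ε) {x : EuclideanSpace ℝ (Fin (n + 2))} (hx : x 0 ≤ 1) :
    ramp n ε x = 0 :=
  max_eq_left ((min_le_right _ _).trans
    (mul_nonpos_of_nonneg_of_nonpos (inv_nonneg.2 hε.le) (sub_nonpos.2 hx)))

lemma ramp_eq_one (hε : 0 < ε) {x : EuclideanSpace ℝ (Fin (n + 2))} (hx : 1 + ε ≤ x 0) :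
    ramp n ε x = 1 := by
  have : 1 ≤ ε⁻¹ * (x 0 - 1) := by
    rw [inv_mul_eq_div, one_le_div hε]
    linarith
  rw [ramp, min_eq_left this, max_eq_right zero_le_one]

lemma lipschitzWith_ramp (hε : 0 < ε) : LipschitzWith (Real.toNNReal ε⁻¹) (ramp n ε) := by
  refine LipschitzWith.const_max (LipschitzWith.const_min ?_ _) _
  refine LipschitzWith.of_dist_le_mul fun x y => ?_
  rw [Real.coe_toNNReal _ (inv_nonneg.2 hε.le), Real.dist_eq, ← mul_sub, abs_mul,
    abs_of_pos (inv_pos.2 hε), sub_sub_sub_cancel_right]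
  gcongr
  rw [← Real.dist_eq]
  exact (dist_le_pi_dist x.ofLp y.ofLp 0).trans
    (by simpa using (PiLp.lipschitzWith_ofLp 2 fun _ : Fin (n + 2) => ℝ).dist_le_mul x y)

lemma norm_fderiv_ramp_le (hε : 0 < ε) (x : EuclideanSpace ℝ (Fin (n + 2))) :
    ‖fderiv ℝ (ramp n ε) x‖ ≤ ε⁻¹ := by
  simpa [hε.le] using norm_fderiv_le_of_lipschitz ℝ (lipschitzWith_ramp (n := n) hε) (x₀ := x)

lemma fderiv_ramp_eq_zero (hε : 0 < ε) {x : EuclideanSpace ℝ (Fin (n + 2))}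
    (hx : x 0 ∉ Set.Icc 1 (1 + ε)) : fderiv ℝ (ramp n ε) x = 0 := by
  have h0c : Continuous fun x : EuclideanSpace ℝ (Fin (n + 2)) => x 0 := by fun_prop
  rcases lt_or_ge (x 0) 1 with h | h
  · have : ramp n ε =ᶠ[𝓝 x] fun _ => 0 :=
      (h0c.continuousAt.eventually (Iio_mem_nhds h)).mono fun y hy => ramp_eq_zero hε (le_of_lt hy)
    rw [this.fderiv_eq, fderiv_const_apply]
  · have h' : 1 + ε < x 0 := lt_of_not_ge fun h'' => hx ⟨h, h''⟩
    have : ramp n ε =ᶠ[𝓝 x] fun _ => 1 :=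
      (h0c.continuousAt.eventually (Ioi_mem_nhds h')).mono fun y hy => ramp_eq_one hε (le_of_lt hy)
    rw [this.fderiv_eq, fderiv_const_apply]

lemma ae_notMem_wall : ∀ᵐ x : EuclideanSpace ℝ (Fin (n + 2)), x ∉ slab n 1 1 1 :=
  measure_eq_zero_iff_ae_notMem.1 (by simp [volume_slab])

/-- A nonnegative function on the perturbed cube supported in `1 ≤ x 0 ≤ 1 + t`
and bounded by `C` has integral at most `C * (t * δ)`. -/
lemma setIntegral_le_of_support {f : EuclideanSpace ℝ (Fin (n + 2)) → ℝ} {C t : ℝ}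
    (hδ : 0 ≤ δ) (ht : 0 ≤ t) (hC : 0 ≤ C) (hf0 : ∀ x, 0 ≤ f x) (hfC : ∀ x, f x ≤ C)
    (hf : ∀ x ∈ cubeWithSlab n δ η, x 0 ∉ Set.Icc 1 (1 + t) → f x = 0) :
    ∫ x in interior (cubeWithSlab n δ η), f x ≤ C * (t * δ) := by
  have hmeas : MeasurableSet (slab n 1 (1 + t) δ) := isClosed_coordBox.measurableSet
  have hint : Integrable ((slab n 1 (1 + t) δ).indicator fun _ => C) :=
    (integrableOn_const volume_coordBox_lt_top.ne).integrable_indicator hmeas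
  calc ∫ x in interior (cubeWithSlab n δ η), f x
      ≤ ∫ x in interior (cubeWithSlab n δ η), (slab n 1 (1 + t) δ).indicator (fun _ => C) x := by
        refine integral_mono_of_nonneg (Eventually.of_forall hf0) hint.restrict ?_
        rw [EventuallyLE, ae_restrict_iff' isOpen_interior.measurableSet]
        filter_upwards [ae_notMem_wall] with x hx hxD
        by_cases hxt : x 0 ∈ Set.Icc 1 (1 + t)
        · rw [Set.indicator_of_mem]
          · exact hfC x
          · rcases interior_subset hxD with h | h
            · have h' := mem_slab.1 h
              exact absurd (mem_slab.2 ⟨⟨hxt.1, h'.1.2⟩, h'.2⟩) hx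
            · exact mem_slab.2 ⟨hxt, (mem_slab.1 h).2⟩
        · rw [hf x (interior_subset hxD) hxt]
          exact Set.indicator_nonneg (fun _ _ => hC) x
    _ ≤ ∫ x, (slab n 1 (1 + t) δ).indicator (fun _ => C) x :=
        setIntegral_le_integral hint
          (Eventually.of_forall (Set.indicator_nonneg fun _ _ => hC))
    _ = C * (t * δ) := by
        rw [integral_indicator_const _ hmeas, measureReal_def, volume_slab, add_sub_cancel_left,
          ENNReal.toReal_mul, ENNReal.toReal_ofReal ht, ENNReal.toReal_ofReal hδ, smul_eq_mul,
          mul_comm]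

lemma integral_fderiv_ramp_le (hδ : 0 ≤ δ) (hε : 0 < ε) :
    ∫ x in interior (cubeWithSlab n δ η), ‖fderiv ℝ (ramp n ε) x‖ ≤ δ := by
  have := setIntegral_le_of_support (n := n) (η := η) hδ hε.le (inv_nonneg.2 hε.le)
    (fun x => norm_nonneg (fderiv ℝ (ramp n ε) x)) (norm_fderiv_ramp_le hε)
    fun x _ hx => by rw [fderiv_ramp_eq_zero hε hx, norm_zero]
  rwa [inv_mul_cancel_left₀ hε.ne'] at this

lemma integral_ramp_le (hδ : 0 ≤ δ) (hη : 0 ≤ η) (hε : 0 < ε) :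
    ∫ x in interior (cubeWithSlab n δ η), |ramp n ε x| ≤ η * δ := by
  have := setIntegral_le_of_support (n := n) (η := η) hδ hη zero_le_one
    (fun x => abs_nonneg (ramp n ε x)) (fun x => (abs_ramp x).trans_le (ramp_le_one x)) ?_
  · rwa [one_mul] at this
  · intro x hx hx'
    have : x 0 ≤ 1 := by
      rcases hx with h | h
      · exact (mem_slab.1 h).1.2
      · exact absurd (mem_slab.1 h).1 hx'
    rw [ramp_eq_zero hε this, abs_zero]

lemma le_integral_frontier_ramp (hδ : 0 < δ) (hε : 0 < ε) (hεη : ε < η) :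
    2 * (η - ε) ≤ ∫ x in frontier (interior (cubeWithSlab n δ η)), |ramp n ε x|
      ∂(μH[((n + 1 : ℕ) : ℝ)]) := by
  set μ : Measure (EuclideanSpace ℝ (Fin (n + 2))) := μH[((n + 1 : ℕ) : ℝ)]
  set F := frontier (interior (cubeWithSlab n δ η))
  have hη := hε.trans hεη
  have hint : IntegrableOn (fun x => |ramp n ε x|) F μ := by
    refine Measure.integrableOn_of_bounded (M := 1) hausdorffMeasure_frontier_lt_top.ne
      (lipschitzWith_ramp hε).continuous.abs.aestronglyMeasurable ?_
    refine Eventually.of_forall fun x => ?_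
    rw [Real.norm_eq_abs, abs_abs, abs_ramp]
    exact ramp_le_one x
  have hface : ∀ c ∈ Set.Icc 0 δ, c ∉ Set.Ioo 0 δ → slabFace n (1 + ε) η δ c ⊆ F ∧
      η - ε ≤ ∫ x in slabFace n (1 + ε) η δ c, |ramp n ε x| ∂μ := by
    intro c hc hc'
    have hsub : slabFace n (1 + ε) η δ c ⊆ F :=
      slabFace_subset_frontier hη hδ (by linarith) hc'
    refine ⟨hsub, ?_⟩
    have hone : ∫ x in slabFace n (1 + ε) η δ c, |ramp n ε x| ∂μ =
        ∫ x in slabFace n (1 + ε) η δ c, (1 : ℝ) ∂μ := by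
      refine setIntegral_congr_fun (isClosed_boxSlice _ _).measurableSet fun x hx => ?_
      simp only [abs_ramp]
      exact ramp_eq_one hε (mem_slab.1 hx.1).1.1
    rw [hone, setIntegral_const, smul_eq_mul, mul_one, measureReal_def,
      ← ENNReal.ofReal_le_iff_le_toReal
        (measure_ne_top_of_subset hsub hausdorffMeasure_frontier_lt_top.ne)]
    refine le_trans (le_of_eq ?_) (sub_le_hausdorffMeasure_slabFace (n := n) (s := 1 + ε) hc)
    congr 1
    ring
  obtain ⟨hs0, h0⟩ := hface 0 ⟨le_rfl, hδ.le⟩ fun h => h.1.false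
  obtain ⟨hs1, h1⟩ := hface δ ⟨hδ.le, le_rfl⟩ fun h => h.2.false
  have hdisj : Disjoint (slabFace n (1 + ε) η δ 0) (slabFace n (1 + ε) η δ δ) :=
    Set.disjoint_left.2 fun x hx hx' => hδ.ne (hx.2.symm.trans hx'.2)
  calc 2 * (η - ε) ≤ _ + _ := by rw [two_mul]; exact add_le_add h0 h1
    _ = ∫ x in slabFace n (1 + ε) η δ 0 ∪ slabFace n (1 + ε) η δ δ, |ramp n ε x| ∂μ :=
        (setIntegral_union hdisj (isClosed_boxSlice _ _).measurableSet
          (hint.mono_set hs0) (hint.mono_set hs1)).symm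
    _ ≤ _ := setIntegral_mono_set hint (Eventually.of_forall fun _ => abs_nonneg _)
        (Set.union_subset hs0 hs1).eventuallyLE

end Ramp

section Lambda

variable {N : ℕ} {D : Set (EuclideanSpace ℝ (Fin N))}

lemma lambda1_quotient_nonneg (u : EuclideanSpace ℝ (Fin N) → ℝ) :
    0 ≤ ((∫ x in D, ‖fderiv ℝ u x‖) + ∫ x in D, |u x|) /
      ∫ x in frontier D, |u x| ∂(μH[(N : ℝ) - 1]) :=
  div_nonneg (add_nonneg (integral_nonneg fun _ => norm_nonneg _)
    (integral_nonneg fun _ => abs_nonneg _)) (integral_nonneg fun _ => abs_nonneg _)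

lemma lambda1_nonneg : 0 ≤ lambda1 D := by
  refine Real.sInf_nonneg ?_
  rintro _ ⟨u, _, _, _, rfl⟩
  exact lambda1_quotient_nonneg u

lemma lambda1_le {u : EuclideanSpace ℝ (Fin N) → ℝ} {K : ℝ≥0} (hu : LipschitzWith K u)
    (h : 0 < ∫ x in frontier D, |u x| ∂(μH[(N : ℝ) - 1])) :
    lambda1 D ≤ ((∫ x in D, ‖fderiv ℝ u x‖) + ∫ x in D, |u x|) /
      ∫ x in frontier D, |u x| ∂(μH[(N : ℝ) - 1]) := by
  refine csInf_le ⟨0, ?_⟩ ⟨u, K, hu, h, rfl⟩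
  rintro _ ⟨v, _, _, _, rfl⟩
  exact lambda1_quotient_nonneg v

end Lambda

lemma lambda1_cubeWithSlab_le {n : ℕ} {δ η : ℝ} (hδ : 0 < δ) (hη : 0 < η) :
    lambda1 (interior (cubeWithSlab n δ η)) ≤ δ * (1 + η) / (2 * η) := by
  have hexp : ((n + 2 : ℕ) : ℝ) - 1 = ((n + 1 : ℕ) : ℝ) := by push_cast; ring
  have hle : ∀ ε ∈ Set.Ioo 0 η,
      lambda1 (interior (cubeWithSlab n δ η)) ≤ δ * (1 + η) / (2 * (η - ε)) := by
    intro ε hε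
    have hb := le_integral_frontier_ramp (n := n) hδ hε.1 hε.2
    have hpos : 0 < 2 * (η - ε) := by linarith [hε.2]
    rw [← hexp] at hb
    refine (lambda1_le (lipschitzWith_ramp hε.1) (hpos.trans_le hb)).trans ?_
    gcongr
    calc _ ≤ δ + η * δ := add_le_add (integral_fderiv_ramp_le hδ.le hε.1)
          (integral_ramp_le hδ.le hη.le hε.1)
      _ = δ * (1 + η) := by ring
  have hlim : Tendsto (fun ε : ℝ => δ * (1 + η) / (2 * (η - ε))) (𝓝[>] 0)
      (𝓝 (δ * (1 + η) / (2 * η))) := by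
    have : ContinuousAt (fun ε : ℝ => δ * (1 + η) / (2 * (η - ε))) 0 := by
      refine ContinuousAt.div (by fun_prop) (by fun_prop) ?_
      simpa using hη.ne'
    simpa using this.tendsto.mono_left nhdsWithin_le_nhds
  exact ge_of_tendsto hlim (Filter.mem_of_superset (Ioo_mem_nhdsGT hη) hle)

lemma volume_symmDiff_le {n : ℕ} {δ η : ℝ} :
    volume (interior (cubeWithSlab n δ η) ∆ interior (slab n 0 1 1)) ≤
      ENNReal.ofReal η * ENNReal.ofReal δ := by
  have hsub : interior (cubeWithSlab n δ η) ∆ interior (slab n 0 1 1) ⊆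
      frontier (slab n 0 1 1) ∪ slab n 1 (1 + η) δ := by
    rintro x (⟨hx, hx'⟩ | ⟨hx, hx'⟩)
    · exact (interior_subset hx).imp (fun h => ⟨subset_closure h, hx'⟩) id
    · exact absurd (interior_mono Set.subset_union_left hx) hx'
  refine (measure_mono hsub).trans ((measure_union_le _ _).trans ?_)
  rw [slab, convex_coordBox.addHaar_frontier volume, zero_add, volume_slab, add_sub_cancel_left]

/-- For the perturbed cube `Q_{δ,η} = int(Q ∪ A_{δ,η})` one has
`λ₁(Q_{δ,η}) ≤ δ(1+η)/(2η)`; in particular, for fixed `η`,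
`λ₁(Q_{δ,η}) → 0` as `δ → 0⁺`, even though `|Q_{δ,η} Δ int Q| → 0`:
`λ₁` is not continuous under convergence of domains in measure. -/
theorem lambda1_not_continuous_in_measure
    (N : ℕ) (hN : 2 ≤ N) (η : ℝ) (hη : η ∈ Set.Ioo (0 : ℝ) 1) :
    (∀ δ ∈ Set.Ioo (0 : ℝ) 1,
      lambda1 (interior (unitCube N ∪ appendixSet N hN δ η)) ≤ δ * (1 + η) / (2 * η)) ∧
    Tendsto (fun δ : ℝ => lambda1 (interior (unitCube N ∪ appendixSet N hN δ η)))
      (𝓝[>] 0) (𝓝 0) ∧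
    Tendsto (fun δ : ℝ =>
        (volume ((interior (unitCube N ∪ appendixSet N hN δ η)) ∆
          (interior (unitCube N)))).toReal)
      (𝓝[>] 0) (𝓝 0) := by
  obtain ⟨n, rfl⟩ : ∃ n, N = n + 2 := ⟨N - 2, by omega⟩
  simp only [appendixSet_eq_slab, unitCube_eq_slab]
  have hbound : ∀ δ ∈ Set.Ioo (0 : ℝ) 1,
      lambda1 (interior (cubeWithSlab n δ η)) ≤ δ * (1 + η) / (2 * η) :=
    fun δ hδ => lambda1_cubeWithSlab_le hδ.1 hη.1
  refine ⟨hbound, ?_, ?_⟩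
  · have hlim : Tendsto (fun δ : ℝ => δ * (1 + η) / (2 * η)) (𝓝[>] 0) (𝓝 0) := by
      have : Continuous fun δ : ℝ => δ * (1 + η) / (2 * η) := by fun_prop
      simpa using (this.tendsto 0).mono_left nhdsWithin_le_nhds
    exact squeeze_zero' (Eventually.of_forall fun _ => lambda1_nonneg)
      (Filter.mem_of_superset (Ioo_mem_nhdsGT one_pos) hbound) hlim
  · have hlim : Tendsto (fun δ : ℝ => η * δ) (𝓝[>] 0) (𝓝 0) := by
      have : Continuous fun δ : ℝ => η * δ := by fun_prop
      simpa using (this.tendsto 0).mono_left nhdsWithin_le_nhds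
    refine squeeze_zero' (Eventually.of_forall fun _ => ENNReal.toReal_nonneg) ?_ hlim
    filter_upwards [self_mem_nhdsWithin] with δ hδ
    refine ENNReal.toReal_le_of_le_ofReal (mul_nonneg hη.1.le (le_of_lt hδ)) ?_
    rw [ENNReal.ofReal_mul hη.1.le]
    exact volume_symmDiff_le
end

section
/- Let N ≥ 1, let Ω ⊂ ℝ^N be a bounded open set, let R : ℝ^N → ℝ^N be a C¹ vector field, and let u be a C¹ real-valued function on an open neighborhood of the closure of Ω. For |δ| small enough that I + δ DR(x) is invertible for all x in the closure of Ω, define g(δ) := ∫_Ω ‖(I + δ DR(x))^{-1} ∇u(x)‖ · det(I + δ DR(x)) dx. Then g is differentiable at δ = 0 with g'(0) = ∫_Ω [ div R(x) ‖∇u(x)‖ − ⟨∇u(x), DR(x) ∇u(x)⟩ / ‖∇u(x)‖ ] dx, where the integrand is interpreted as 0 at points where ∇u(x) = 0; equivalently g'(0) = ∫_Ω f(ν(x)) ‖∇u(x)‖ dx with ν(x) = ∇u(x)/‖∇u(x)‖ and f(X) := div R − ⟨X, DR · X⟩. -/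
open MeasureTheory Filter Topology Classical
open scoped ENNReal NNReal RealInnerProductSpace

namespace ContinuousLinearMap

section Det

variable {E : Type*} [NormedAddCommGroup E] [NormedSpace ℝ E] [FiniteDimensional ℝ E]

/-- The determinant is a smooth function on the endomorphisms of a finite-dimensional space. -/
theorem contDiff_det {n : WithTop ℕ∞} : ContDiff ℝ n fun A : E →L[ℝ] E => A.det := by
  have h : (fun A : E →L[ℝ] E => A.det) = fun A : E →L[ℝ] E =>
      (LinearMap.toMatrix (Module.finBasis ℝ E) (Module.finBasis ℝ E)
        (A : E →ₗ[ℝ] E)).det := by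
    funext A
    rw [LinearMap.det_toMatrix]
  rw [h]
  simp only [Matrix.det_apply']
  refine ContDiff.sum fun σ _ => contDiff_const.mul (contDiff_prod fun i _ => ?_)
  let entry : (E →L[ℝ] E) →ₗ[ℝ] ℝ :=
    (Matrix.entryLinearMap ℝ ℝ (σ i) i).comp
      ((LinearMap.toMatrix (Module.finBasis ℝ E) (Module.finBasis ℝ E)).toLinearMap.comp
        (coeLM ℝ))
  exact (LinearMap.toContinuousLinearMap entry).contDiff

/-- Jacobi's formula at the identity: the derivative of `δ ↦ det (1 + δ A)` at `0` is the trace. -/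
theorem hasDerivAt_det_one_add_smul (A : E →L[ℝ] E) :
    HasDerivAt (fun δ : ℝ => ((1 : E →L[ℝ] E) + δ • A).det)
      (LinearMap.trace ℝ E (A : E →ₗ[ℝ] E)) 0 := by
  let b := Module.finBasis ℝ E
  set M := LinearMap.toMatrix b b (A : E →ₗ[ℝ] E) with hM
  set p := (1 + (Polynomial.X : Polynomial ℝ) • M.map Polynomial.C).det with hp
  have h : (fun δ : ℝ => ((1 : E →L[ℝ] E) + δ • A).det) = fun δ => p.eval δ := by
    funext δ
    have h1 : ((1 : E →L[ℝ] E) + δ • A).det = (1 + δ • M).det := by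
      rw [ContinuousLinearMap.det, ← LinearMap.det_toMatrix b]
      congr 1
      rw [toLinearMap_add, toLinearMap_smul, map_add, map_smul, toLinearMap_one,
        LinearMap.toMatrix_one]
    rw [h1, hp, ← Polynomial.coe_evalRingHom, RingHom.map_det]
    congr 1
    ext i j
    simp [Matrix.one_apply, apply_ite]
    ring
  rw [h, LinearMap.trace_eq_matrix_trace ℝ b, ← hM, ← Matrix.derivative_det_one_add_X_smul]
  exact p.hasDerivAt 0

/-- `det A • A⁻¹` is continuously differentiable near the identity. -/
theorem contDiffAt_det_smul_ringInverse :
    ContDiffAt ℝ 1 (fun A : E →L[ℝ] E => A.det • Ring.inverse A) 1 :=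
  contDiff_det.contDiffAt.smul (contDiffAt_ringInverse ℝ (1 : (E →L[ℝ] E)ˣ))

/-- The derivative of `det (1 + δ A) (1 + δ A)⁻¹` at `δ = 0` is `tr A - A`. -/
theorem hasDerivAt_det_smul_ringInverse_one_add_smul (A : E →L[ℝ] E) :
    HasDerivAt (fun δ : ℝ => ((1 : E →L[ℝ] E) + δ • A).det •
      Ring.inverse ((1 : E →L[ℝ] E) + δ • A))
      (LinearMap.trace ℝ E (A : E →ₗ[ℝ] E) • (1 : E →L[ℝ] E) - A) 0 := by
  have hline : HasDerivAt (fun δ : ℝ => (1 : E →L[ℝ] E) + δ • A) A 0 := by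
    simpa using ((hasDerivAt_id (0 : ℝ)).smul_const A).const_add (1 : E →L[ℝ] E)
  have hinv : HasDerivAt (fun δ : ℝ => Ring.inverse ((1 : E →L[ℝ] E) + δ • A)) (-A) 0 := by
    have h := hasFDerivAt_ringInverse (𝕜 := ℝ) (1 : (E →L[ℝ] E)ˣ)
    have h' := HasFDerivAt.comp_hasDerivAt_of_eq (0 : ℝ) h hline (by simp)
    simpa using! h'
  have h := (hasDerivAt_det_one_add_smul A).smul hinv
  convert! h using 1
  simp [ContinuousLinearMap.det, sub_eq_add_neg, add_comm]

end Det

section TotalVariation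

variable {E : Type*} [NormedAddCommGroup E] [InnerProductSpace ℝ E]

theorem _root_.HasDerivAt.norm_of_ne_zero {w : ℝ → E} {w' : E} {t : ℝ} (hw : HasDerivAt w w' t)
    (h0 : w t ≠ 0) : HasDerivAt (fun s => ‖w s‖) (⟪w t, w'⟫ / ‖w t‖) t := by
  have h := hw.norm_sq.sqrt (by simpa using h0)
  simp only [Real.sqrt_sq (norm_nonneg _)] at h
  convert! h using 1
  rw [mul_div_mul_left _ _ two_ne_zero]

theorem norm_ringInverse_apply_mul_det {B : E →L[ℝ] E} (hB : 0 < B.det) (v : E) :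
    ‖Ring.inverse B v‖ * B.det = ‖(B.det • Ring.inverse B) v‖ := by
  rw [smul_apply, norm_smul, Real.norm_of_nonneg hB.le, mul_comm]

theorem norm_ringInverse_apply_mul_det_one_add_zero_smul (A : E →L[ℝ] E) (v : E) :
    ‖Ring.inverse ((1 : E →L[ℝ] E) + (0 : ℝ) • A) v‖ * ((1 : E →L[ℝ] E) + (0 : ℝ) • A).det =
      ‖v‖ := by
  simp [ContinuousLinearMap.det]

theorem eventually_det_pos : ∀ᶠ B : E →L[ℝ] E in 𝓝 1, 0 < B.det :=
  continuous_det.continuousAt.eventually_const_lt (by simp [ContinuousLinearMap.det])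

variable [FiniteDimensional ℝ E]

/-- The pointwise derivative of the transported integrand of the total variation. -/
theorem hasDerivAt_norm_ringInverse_apply_mul_det (A : E →L[ℝ] E) (v : E) [Decidable (v = 0)] :
    HasDerivAt (fun δ : ℝ => ‖Ring.inverse ((1 : E →L[ℝ] E) + δ • A) v‖ *
        ((1 : E →L[ℝ] E) + δ • A).det)
      (if v = 0 then (0 : ℝ) else
        LinearMap.trace ℝ E (A : E →ₗ[ℝ] E) * ‖v‖ - ⟪v, A v⟫ / ‖v‖) 0 := by
  split_ifs with hv
  · subst hv
    simpa using hasDerivAt_const (0 : ℝ) (0 : ℝ)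
  have hcont : Tendsto (fun δ : ℝ => (1 : E →L[ℝ] E) + δ • A) (𝓝 0) (𝓝 1) :=
    Continuous.tendsto' (by fun_prop) _ _ (by simp)
  have hw := (hasDerivAt_det_smul_ringInverse_one_add_smul A).clm_apply
    (hasDerivAt_const (0 : ℝ) v)
  have hw0 : (((1 : E →L[ℝ] E) + (0 : ℝ) • A).det •
      Ring.inverse ((1 : E →L[ℝ] E) + (0 : ℝ) • A)) v = v := by
    simp [ContinuousLinearMap.det]
  have h := hw.norm_of_ne_zero (by rwa [hw0])
  rw [hw0] at h
  have hv' : ‖v‖ ≠ 0 := norm_ne_zero_iff.2 hv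
  have hval : ⟪v, (LinearMap.trace ℝ E (A : E →ₗ[ℝ] E) • (1 : E →L[ℝ] E) - A) v⟫ / ‖v‖ =
      LinearMap.trace ℝ E (A : E →ₗ[ℝ] E) * ‖v‖ - ⟪v, A v⟫ / ‖v‖ := by
    simp only [sub_apply, smul_apply, one_apply_eq_self, inner_sub_right, inner_smul_right,
      real_inner_self_eq_norm_sq]
    field_simp
  rw [← hval]
  refine HasDerivAt.congr_of_eventuallyEq (by simpa using! h) ?_
  filter_upwards [hcont.eventually eventually_det_pos] with δ hδ
  exact norm_ringInverse_apply_mul_det hδ v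

/-- Near the identity, `B ↦ ‖B⁻¹ v‖ det B` is Lipschitz with constant proportional to `‖v‖`. -/
theorem exists_lipschitz_norm_ringInverse_apply_mul_det :
    ∃ ε > 0, ∃ K : ℝ≥0,
      (∀ v : E, LipschitzOnWith (K * ‖v‖₊) (fun B : E →L[ℝ] E => ‖Ring.inverse B v‖ * B.det)
        (Metric.ball 1 ε)) ∧
      ContinuousOn (fun B : E →L[ℝ] E => B.det • Ring.inverse B) (Metric.ball 1 ε) ∧
      ∀ B ∈ Metric.ball (1 : E →L[ℝ] E) ε, 0 < B.det := by
  obtain ⟨K, t, ht, hK⟩ := (contDiffAt_det_smul_ringInverse (E := E)).exists_lipschitzOnWith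
  obtain ⟨ε, hε, hball⟩ := Metric.mem_nhds_iff.1 (inter_mem ht (eventually_det_pos (E := E)))
  have hpos : ∀ B ∈ Metric.ball (1 : E →L[ℝ] E) ε, 0 < B.det := fun B hB => (hball hB).2
  have hK' := hK.mono fun B hB => (hball hB).1
  refine ⟨ε, hε, K, fun v => LipschitzOnWith.of_dist_le_mul fun B hB B' hB' => ?_,
    hK'.continuousOn, hpos⟩
  rw [norm_ringInverse_apply_mul_det (hpos B hB), norm_ringInverse_apply_mul_det (hpos B' hB')]
  calc dist ‖(B.det • Ring.inverse B) v‖ ‖(B'.det • Ring.inverse B') v‖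
      ≤ ‖(B.det • Ring.inverse B - B'.det • Ring.inverse B') v‖ := by
        rw [sub_apply]
        exact abs_norm_sub_norm_le _ _
    _ ≤ ‖B.det • Ring.inverse B - B'.det • Ring.inverse B'‖ * ‖v‖ := le_opNorm _ _
    _ ≤ (K * dist B B') * ‖v‖ := by
        gcongr
        rw [← dist_eq_norm]
        exact hK'.dist_le_mul B hB B' hB'
    _ = _ := by push_cast; ring

end TotalVariation

end ContinuousLinearMap

theorem measurable_gradient {E : Type*} [NormedAddCommGroup E] [InnerProductSpace ℝ E]
    [FiniteDimensional ℝ E] [MeasurableSpace E] [BorelSpace E] (u : E → ℝ) :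
    Measurable (gradient u) :=
  (InnerProductSpace.toDual ℝ E).symm.continuous.measurable.comp (measurable_fderiv ℝ u)

/-- For a bounded open `Ω`, a `C¹` vector field `R` and a function `u` which is
`C¹` on an open neighborhood of `closure Ω`, the map
`g(δ) = ∫_Ω ‖(I + δ DR(x))⁻¹ ∇u(x)‖ det(I + δ DR(x)) dx`
(the inverse being taken in the ring of continuous endomorphisms, with junk
value `0` where not invertible — which does not happen for small `δ`) is
differentiable at `δ = 0` with
`g'(0) = ∫_Ω [div R ‖∇u‖ − ⟨∇u, DR ∇u⟩/‖∇u‖] dx`, the integrand being `0`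
where `∇u = 0`. -/
theorem shape_derivative_of_total_variation
    (N : ℕ) (hN : 1 ≤ N) (Ω : Set (EuclideanSpace ℝ (Fin N)))
    (hΩo : IsOpen Ω) (hΩb : Bornology.IsBounded Ω)
    (R : EuclideanSpace ℝ (Fin N) → EuclideanSpace ℝ (Fin N))
    (hR : ContDiff ℝ 1 R)
    (u : EuclideanSpace ℝ (Fin N) → ℝ)
    (U : Set (EuclideanSpace ℝ (Fin N))) (hU : IsOpen U)
    (hΩU : closure Ω ⊆ U) (hu : ContDiffOn ℝ 1 u U) :
    HasDerivAt
      (fun δ : ℝ => ∫ x in Ω,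
        ‖Ring.inverse
            ((1 : EuclideanSpace ℝ (Fin N) →L[ℝ] EuclideanSpace ℝ (Fin N))
              + δ • fderiv ℝ R x) (gradient u x)‖ *
          ContinuousLinearMap.det
            ((1 : EuclideanSpace ℝ (Fin N) →L[ℝ] EuclideanSpace ℝ (Fin N))
              + δ • fderiv ℝ R x))
      (∫ x in Ω,
        if gradient u x = 0 then (0 : ℝ) else
          LinearMap.trace ℝ (EuclideanSpace ℝ (Fin N))
              (fderiv ℝ R x : EuclideanSpace ℝ (Fin N) →ₗ[ℝ] EuclideanSpace ℝ (Fin N))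
            * ‖gradient u x‖
          - ⟪gradient u x, fderiv ℝ R x (gradient u x)⟫ / ‖gradient u x‖)
      0 := by
  have hcl : IsCompact (closure Ω) := hΩb.isCompact_closure
  have hDR : Continuous (fderiv ℝ R) := hR.continuous_fderiv one_ne_zero
  obtain ⟨M, hM⟩ := hcl.exists_bound_of_continuousOn hDR.continuousOn
  have hDu : ContinuousOn (fderiv ℝ u) (closure Ω) :=
    (hu.continuousOn_fderiv_of_isOpen hU le_rfl).mono hΩU
  obtain ⟨C, hC⟩ := hcl.exists_bound_of_continuousOn hDu
  have hgrad_norm : ∀ x, ‖gradient u x‖ = ‖fderiv ℝ u x‖ := fun x =>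
    (InnerProductSpace.toDual ℝ _).symm.norm_map _
  have hgrad := measurable_gradient u
  have hfin : IsFiniteMeasure (volume.restrict Ω) :=
    isFiniteMeasure_restrict.2 hΩb.measure_lt_top.ne
  have hmem : ∀ᵐ x ∂volume.restrict Ω, x ∈ closure Ω :=
    (ae_restrict_mem hΩo.measurableSet).mono fun x hx => subset_closure hx
  have hgrad_int : Integrable (fun x => ‖gradient u x‖) (volume.restrict Ω) :=
    Integrable.of_bound hgrad.norm.aestronglyMeasurable C
      (hmem.mono fun x hx => by rw [norm_norm, hgrad_norm]; exact hC x hx)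
  obtain ⟨ε, hε, K, hLip, hcont, hpos⟩ :=
    ContinuousLinearMap.exists_lipschitz_norm_ringInverse_apply_mul_det
      (E := EuclideanSpace ℝ (Fin N))
  set L : ℝ := max M 1
  have hL : 0 < L := lt_max_of_lt_right one_pos
  have hball : ∀ δ ∈ Metric.ball (0 : ℝ) (ε / L), ∀ x ∈ closure Ω,
      (1 : EuclideanSpace ℝ (Fin N) →L[ℝ] EuclideanSpace ℝ (Fin N)) + δ • fderiv ℝ R x ∈
        Metric.ball 1 ε := by
    intro δ hδ x hx
    rw [mem_ball_zero_iff, lt_div_iff₀ hL] at hδ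
    rw [mem_ball_iff_norm, add_sub_cancel_left, norm_smul]
    refine lt_of_le_of_lt ?_ hδ
    gcongr
    exact (hM x hx).trans (le_max_left _ _)
  have hs : Metric.ball (0 : ℝ) (ε / L) ∈ 𝓝 0 := Metric.ball_mem_nhds _ (div_pos hε hL)
  refine (hasDerivAt_integral_of_dominated_loc_of_lip
    (bound := fun x => K * ‖gradient u x‖ * L) hs ?_ ?_ ?_ ?_ ?_ ?_).2
  · filter_upwards [hs] with δ hδ
    have hop : AEStronglyMeasurable (fun x =>
        ((1 : EuclideanSpace ℝ (Fin N) →L[ℝ] EuclideanSpace ℝ (Fin N)) + δ • fderiv ℝ R x).det •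
          Ring.inverse (1 + δ • fderiv ℝ R x)) (volume.restrict Ω) :=
      (hcont.comp (by fun_prop) fun x hx => hball δ hδ x (subset_closure hx)).aestronglyMeasurable
        hΩo.measurableSet
    refine (isBoundedBilinearMap_apply.continuous.comp_aestronglyMeasurable
      (hop.prodMk hgrad.aestronglyMeasurable)).norm.congr (hmem.mono fun x hx => ?_)
    exact (ContinuousLinearMap.norm_ringInverse_apply_mul_det (hpos _ (hball δ hδ x hx)) _).symm
  · exact hgrad_int.congr (Eventually.of_forall fun x =>
      (ContinuousLinearMap.norm_ringInverse_apply_mul_det_one_add_zero_smul _ _).symm)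
  · have htr : Measurable fun x => LinearMap.trace ℝ (EuclideanSpace ℝ (Fin N))
        (fderiv ℝ R x : EuclideanSpace ℝ (Fin N) →ₗ[ℝ] EuclideanSpace ℝ (Fin N)) :=
      (((LinearMap.trace ℝ (EuclideanSpace ℝ (Fin N))).comp
        (ContinuousLinearMap.coeLM ℝ)).continuous_of_finiteDimensional.comp hDR).measurable
    have hap : Measurable fun x => fderiv ℝ R x (gradient u x) :=
      (isBoundedBilinearMap_apply.continuous.comp_stronglyMeasurable
        (hDR.stronglyMeasurable.prodMk hgrad.stronglyMeasurable)).measurable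
    exact (Measurable.ite (hgrad (measurableSet_singleton 0)) measurable_const
      ((htr.mul hgrad.norm).sub ((hgrad.inner hap).div hgrad.norm))).aestronglyMeasurable
  · refine hmem.mono fun x hx => LipschitzOnWith.of_dist_le_mul fun δ hδ δ' hδ' => ?_
    refine ((hLip (gradient u x)).dist_le_mul _ (hball δ hδ x hx) _ (hball δ' hδ' x hx)).trans ?_
    rw [dist_add_left, dist_eq_norm, ← sub_smul, norm_smul, ← dist_eq_norm, Real.coe_nnabs,
      abs_of_nonneg (by positivity)]
    calc _ ≤ K * ‖gradient u x‖ * (dist δ δ' * L) := by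
          push_cast
          gcongr
          exact (hM x hx).trans (le_max_left _ _)
      _ = _ := by ring
  · exact (hgrad_int.const_mul _).mul_const _
  · exact Eventually.of_forall fun x =>
      ContinuousLinearMap.hasDerivAt_norm_ringInverse_apply_mul_det _ _
end
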